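/- Let k ∈ ℕ, let ν be a k-th level Bernoulli measure on Σ = D^ℕ giving positive measure to every cylinder of length k, let φ_1,…,φ_m : Σ → ℝ be continuous, let j ∈ {1,…,d}, and let ε, δ > 0. Then there exist N ∈ ℕ and a Borel set S ⊆ Σ with ν(S) > 1 − δ such that for all ω ∈ S, all n ≥ N and all l = 1,…,m: (i) | (1/(nk)) Σ_{r=0}^{nk−1} φ_l(σ^r ω) − ∫ A_k(φ_l) dν | < ε; (ii) | (1/(nk)) log ν∘χ_j^{−1}([η_j(ω_1)⋯η_j(ω_{nk})]) + (1/k) h_{ν∘χ_j^{−1}}(σ_j^k) | < ε; and (iii) every digit of D occurs among ω_1,…,ω_N. -/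

import Mathlib

open MeasureTheory Filter Topology Metric Set
open scoped ENNReal NNReal

noncomputable section

/-- Shannon entropy of the partition of `X` induced by a map into a finite type. -/
def entPart {X : Type*} [MeasurableSpace X] (μ : Measure X) {ι : Type*} [Fintype ι]
    (p : X → ι) : ℝ :=
  ∑ i, Real.negMulLog ((μ (p ⁻¹' {i})).toReal)

/-- Kolmogorov–Sinai (measure-theoretic) entropy of `T` with respect to `μ`:
the supremum over finite measurable partitions (coded by measurable maps into `Fin m`)
of the limit (= infimum, by subadditivity) of the averaged entropies of the dynamical
refinements of the partition. -/
def ksEntropy {X : Type*} [MeasurableSpace X] (T : X → X) (μ : Measure X) : ℝ :=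
  ⨆ m : ℕ, ⨆ p : {p : X → Fin m // Measurable p},
    ⨅ n : ℕ, ((n : ℝ) + 1)⁻¹ *
      entPart μ (fun x => fun k : Fin (n + 1) => p.1 (T^[(k : ℕ)] x))

/-- Minimal number of balls of radius `r` needed to cover `s`. -/
def coverN {X : Type*} [PseudoMetricSpace X] (s : Set X) (r : ℝ) : ℕ :=
  sInf {n : ℕ | ∃ t : Finset X, t.card = n ∧ s ⊆ ⋃ x ∈ t, Metric.ball x r}

/-- Upper box (Minkowski) dimension. -/
def upperBoxDim {X : Type*} [PseudoMetricSpace X] (s : Set X) : ℝ :=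
  Filter.limsup (fun r : ℝ => Real.log (coverN s r) / Real.log r⁻¹) (nhdsWithin 0 (Set.Ioi 0))

/-- Packing dimension, via countable covers and upper box dimension. -/
def packingDim {X : Type*} [PseudoMetricSpace X] (s : Set X) : ℝ :=
  ⨅ C : {C : ℕ → Set X // s ⊆ ⋃ n, C n}, ⨆ n, upperBoxDim (C.1 n)

/-- The `n`-th empirical (Birkhoff average) measure `A_{n+1}(δ_x)` of the orbit of `x`. -/
def empirical {X : Type*} [MeasurableSpace X] (T : X → X) (x : X) (n : ℕ) : Measure X :=
  (((n : ℝ≥0∞) + 1))⁻¹ • ∑ l ∈ Finset.range (n + 1), Measure.dirac (T^[l] x)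

instance empirical_prob {X : Type*} [MeasurableSpace X] (T : X → X) (x : X) (n : ℕ) :
    IsProbabilityMeasure (empirical T x n) := by
  constructor
  have h : ∀ l : ℕ, Measure.dirac (T^[l] x) (Set.univ : Set X) = 1 := fun l => by
    simp [measure_univ]
  simp only [empirical, Measure.smul_apply, Measure.coe_finset_sum, Finset.sum_apply, h,
    Finset.sum_const, Finset.card_range, nsmul_eq_mul, mul_one, smul_eq_mul]
  rw [Nat.cast_add, Nat.cast_one, ENNReal.inv_mul_cancel] <;> simp [Nat.cast_add_one_ne_zero]

/-- The `n`-th empirical measure as a probability measure. -/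
def empiricalPM {X : Type*} [MeasurableSpace X] (T : X → X) (x : X) (n : ℕ) :
    ProbabilityMeasure X := ⟨empirical T x n, empirical_prob T x n⟩

/-- `V(x)`: the set of weak* accumulation points of the sequence of empirical measures of `x`. -/
def accPts {X : Type*} [MeasurableSpace X] [TopologicalSpace X] [OpensMeasurableSpace X]
    (T : X → X) (x : X) : Set (ProbabilityMeasure X) :=
  {μ | MapClusterPt μ atTop (fun n => empiricalPM T x n)}

/-- A probability measure is invariant for `T`. -/
def IsInvariantPM {X : Type*} [MeasurableSpace X] (T : X → X)
    (μ : ProbabilityMeasure X) : Prop :=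
  (μ : Measure X).map T = (μ : Measure X)

/-- Convexity of a set of probability measures. -/
def IsConvexPMSet {X : Type*} [MeasurableSpace X] (A : Set (ProbabilityMeasure X)) : Prop :=
  ∀ μ ∈ A, ∀ ν ∈ A, ∀ t : ℝ≥0, t ≤ 1 → ∀ ρ : ProbabilityMeasure X,
    (ρ : Measure X) = t • (μ : Measure X) + (1 - t) • (ν : Measure X) → ρ ∈ A


/-- The left shift. -/
def shiftMap {β : Type*} (ω : ℕ → β) : ℕ → β := fun n => ω (n + 1)

/-- The index set of the first `d + 1 - j` coordinates (those kept by `η_{j+1}`). -/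
def TruncIdx (d : ℕ) (j : Fin (d + 1)) : Type := {q : Fin (d + 1) // q.1 + j.1 < d + 1}

/-- `η_{j+1}` : drop the last `j` coordinates of a digit. -/
def ηmap {d : ℕ} (j : Fin (d + 1)) (v : Fin (d + 1) → ℕ) : TruncIdx d j → ℕ :=
  fun q => v q.1

/-- The symbolic space `Σ = D^ℕ` over the digit set `D`. -/
abbrev SymbSpace {d : ℕ} (D : Finset (Fin (d + 1) → ℕ)) : Type := ℕ → {v // v ∈ D}

/-- `χ_{j+1} : Σ → Σ_{j+1}`, coordinatewise application of `η_{j+1}`. -/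
def chi {d : ℕ} (D : Finset (Fin (d + 1) → ℕ)) (j : Fin (d + 1)) (ω : SymbSpace D) :
    ℕ → (TruncIdx d j → ℕ) := fun n => ηmap j (ω n).1

/-- The coding map `Π : Σ → 𝕋^{d+1}`. -/
def coding {d : ℕ} (a : Fin (d + 1) → ℕ) (D : Finset (Fin (d + 1) → ℕ)) (ω : SymbSpace D) :
    Fin (d + 1) → AddCircle (1 : ℝ) :=
  fun q => ((∑' ν : ℕ, ((ω ν).1 q : ℝ) / (a q : ℝ) ^ (ν + 1) : ℝ) : AddCircle (1 : ℝ))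

/-- The self-affine Sierpiński sponge `Λ`. -/
def sponge {d : ℕ} (a : Fin (d + 1) → ℕ) (D : Finset (Fin (d + 1) → ℕ)) :
    Set (Fin (d + 1) → AddCircle (1 : ℝ)) := Set.range (coding a D)

/-- λ-exponents `λ_k = log a_{d+1} / log a_k` (with `λ_0 = 0`), indexed by `k : ℕ`. -/
def lamN (d : ℕ) (a : Fin (d + 1) → ℕ) (k : ℕ) : ℝ :=
  if h : k ≤ d + 1 ∧ 0 < k then
    Real.log (a (Fin.last d)) / Real.log (a ⟨k - 1, by omega⟩) else 0

/-- The torus map `f`. -/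
def affineTorusMap {d : ℕ} (a : Fin (d + 1) → ℕ) (x : Fin (d + 1) → AddCircle (1 : ℝ)) :
    Fin (d + 1) → AddCircle (1 : ℝ) := fun q => a q • x q

/-- Index set for `π_{j+1}` : the coordinates `≥ j`. -/
def ProjIdx (d : ℕ) (j : Fin (d + 1)) : Type := {q : Fin (d + 1) // j ≤ q}

/-- `π_{j+1} : 𝕋^{d+1} → 𝕋^{d+1-j}`. -/
def torusProj {d : ℕ} (j : Fin (d + 1)) (x : Fin (d + 1) → AddCircle (1 : ℝ)) :
    ProjIdx d j → AddCircle (1 : ℝ) := fun q => x q.1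

/-- `f_{j+1}`, the factor map on the last coordinates. -/
def torusFactorMap {d : ℕ} (a : Fin (d + 1) → ℕ) (j : Fin (d + 1))
    (x : ProjIdx d j → AddCircle (1 : ℝ)) : ProjIdx d j → AddCircle (1 : ℝ) :=
  fun q => a q.1 • x q

/-- The spectrum combination `H_1/log a_1 + Σ_{k=2}^{d+1} (1/log a_k - 1/log a_{k-1}) H_k`. -/
def dimCombo {d : ℕ} (a : Fin (d + 1) → ℕ) (H : Fin (d + 1) → ℝ) : ℝ :=
  H 0 / Real.log (a 0) +
    ∑ i : Fin d, (1 / Real.log (a i.succ) - 1 / Real.log (a i.castSucc)) * H i.succ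


/-- The cylinder set determined by a word of length `n`. -/
def cylinderSet {β : Type*} (n : ℕ) (w : Fin n → β) : Set (ℕ → β) :=
  {ω | ∀ i : Fin n, ω i.1 = w i}

/-- The index of the `i`-th letter of the `r`-th `k`-block. -/
def blockIdx {n k : ℕ} (r : Fin n) (i : Fin k) : Fin (n * k) :=
  ⟨r.1 * k + i.1, by
    have hi := i.2
    have hr := r.2
    have h1 : r.1 * k + i.1 < (r.1 + 1) * k := by rw [add_mul, one_mul]; omega
    exact lt_of_lt_of_le h1 (Nat.mul_le_mul_right k hr)⟩

/-- `ν` is a `k`-th level Bernoulli measure: the consecutive `k`-blocks are i.i.d. -/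
def IsBernoulliBlock {β : Type*} [MeasurableSpace β] [Fintype β] (k : ℕ)
    (ν : Measure (ℕ → β)) : Prop :=
  ∃ p : (Fin k → β) → ℝ≥0∞, (∑ b, p b = 1) ∧
    ∀ n : ℕ, ∀ w : Fin (n * k) → β,
      ν (cylinderSet (n * k) w) = ∏ r : Fin n, p (fun i => w (blockIdx r i))

/-- The Birkhoff average `A_k(φ)`. -/
def birkAvg {β : Type*} (k : ℕ) (φ : (ℕ → β) → ℝ) (ω : ℕ → β) : ℝ :=
  (k : ℝ)⁻¹ * ∑ l ∈ Finset.range k, φ (shiftMap^[l] ω)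

theorem sum_range_mul_eq (y : ℕ → ℝ) (L N : ℕ) :
    ∑ s ∈ Finset.range (N * L), y s =
      ∑ t ∈ Finset.range N, ∑ c ∈ Finset.range L, y (t * L + c) := by
  induction N with
  | zero => simp
  | succ N ih => rw [Nat.succ_mul, Finset.sum_range_add, ih, Finset.sum_range_succ]

theorem tendsto_average_of_residues {y : ℕ → ℝ} {C e : ℝ} (hy : ∀ s, |y s| ≤ C) {L : ℕ}
    (hL : 0 < L)
    (h : ∀ c < L, Tendsto (fun n : ℕ => (n : ℝ)⁻¹ * ∑ t ∈ Finset.range n, y (t * L + c))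
      atTop (𝓝 e)) :
    Tendsto (fun n : ℕ => (n : ℝ)⁻¹ * ∑ s ∈ Finset.range n, y s) atTop (𝓝 e) := by
  have hLR : (0 : ℝ) < L := by exact_mod_cast hL
  have hdiv : Tendsto (fun n : ℕ => n / L) atTop atTop := Nat.tendsto_div_const_atTop hL.ne'
  have hblock : Tendsto (fun N : ℕ => ∑ c ∈ Finset.range L,
      (N : ℝ)⁻¹ * ∑ t ∈ Finset.range N, y (t * L + c)) atTop (𝓝 (L * e)) := by
    have := tendsto_finsetSum (Finset.range L) (fun c hc => h c (Finset.mem_range.1 hc))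
    simpa using this
  have hratio : Tendsto (fun n : ℕ => ((n / L : ℕ) : ℝ) / n) atTop (𝓝 (L : ℝ)⁻¹) := by
    have h1 : Tendsto (fun n : ℕ => (L : ℝ)⁻¹ - (n : ℝ)⁻¹) atTop (𝓝 ((L : ℝ)⁻¹ - 0)) :=
      tendsto_const_nhds.sub tendsto_inv_atTop_nhds_zero_nat
    rw [sub_zero] at h1
    refine tendsto_of_tendsto_of_tendsto_of_le_of_le' h1 tendsto_const_nhds ?_ ?_
    · filter_upwards [eventually_gt_atTop 0] with n hn
      have hnR : (0 : ℝ) < n := by exact_mod_cast hn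
      have h2 : n < (n / L + 1) * L := by
        have := Nat.lt_mul_div_succ n hL
        rw [mul_comm]; exact this
      have h3 : (n : ℝ) ≤ (((n / L : ℕ) : ℝ) + 1) * L := by exact_mod_cast h2.le
      rw [le_div_iff₀ hnR, sub_mul, inv_mul_cancel₀ hnR.ne', sub_le_iff_le_add,
        inv_mul_le_iff₀ hLR]
      linarith
    · filter_upwards [eventually_gt_atTop 0] with n hn
      have hnR : (0 : ℝ) < n := by exact_mod_cast hn
      rw [div_le_iff₀ hnR, inv_mul_eq_div, le_div_iff₀ hLR]
      exact_mod_cast Nat.div_mul_le_self n L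
  have hrem : Tendsto (fun n : ℕ => (n : ℝ)⁻¹ * ∑ c ∈ Finset.range (n % L), y (n / L * L + c))
      atTop (𝓝 0) := by
    have h1 : Tendsto (fun n : ℕ => (n : ℝ)⁻¹ * (L * C)) atTop (𝓝 (0 * (L * C))) :=
      tendsto_inv_atTop_nhds_zero_nat.mul_const _
    rw [zero_mul] at h1
    refine squeeze_zero_norm (fun n => ?_) h1
    rw [Real.norm_eq_abs, abs_mul, abs_of_nonneg (by positivity : (0 : ℝ) ≤ (n : ℝ)⁻¹)]
    refine mul_le_mul_of_nonneg_left ?_ (by positivity)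
    refine (Finset.abs_sum_le_sum_abs _ _).trans ((Finset.sum_le_sum fun c _ => hy _).trans ?_)
    rw [Finset.sum_const, Finset.card_range, nsmul_eq_mul]
    have hC : 0 ≤ C := (abs_nonneg _).trans (hy 0)
    refine mul_le_mul_of_nonneg_right ?_ hC
    exact_mod_cast (Nat.mod_lt n hL).le
  have key := (hratio.mul (hblock.comp hdiv)).add hrem
  have he : (L : ℝ)⁻¹ * (L * e) + 0 = e := by field_simp; simp
  rw [he] at key
  refine key.congr' ?_
  filter_upwards [eventually_ge_atTop L] with n hn
  have hq : (0 : ℝ) < ((n / L : ℕ) : ℝ) := by exact_mod_cast Nat.div_pos hn hL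
  have hsplit : ∑ s ∈ Finset.range n, y s = ∑ s ∈ Finset.range (n / L * L), y s +
      ∑ c ∈ Finset.range (n % L), y (n / L * L + c) := by
    rw [← Finset.sum_range_add, Nat.div_add_mod']
  rw [hsplit, sum_range_mul_eq, Finset.sum_comm, mul_add, Function.comp_apply,
    ← Finset.mul_sum]
  congr 1
  field_simp

/-- The sequence of letters read by `g` along the orbit of `ω`. -/
def itinerary {Ω A : Type*} (T : Ω → Ω) (g : Ω → A) (ω : Ω) : ℕ → A := fun s => g (T^[s] ω)

theorem itinerary_iterate {Ω A : Type*} (T : Ω → Ω) (g : Ω → A) (ω : Ω) (s : ℕ) :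
    itinerary T g (T^[s] ω) = fun i => itinerary T g ω (s + i) := by
  funext i
  simp only [itinerary]
  rw [add_comm, Function.iterate_add_apply]

theorem measurable_itinerary {Ω A : Type*} [MeasurableSpace Ω] [MeasurableSpace A] {T : Ω → Ω}
    {g : Ω → A} (hT : Measurable T) (hg : Measurable g) : Measurable (itinerary T g) :=
  measurable_pi_lambda _ fun s => hg.comp (hT.iterate s)

theorem measurable_of_dependsOn_Iio {A β : Type*} [MeasurableSpace A] [Finite A]
    [MeasurableSingletonClass A] [MeasurableSpace β] {F : (ℕ → A) → β} {L : ℕ}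
    (hF : DependsOn F (Iio L)) : Measurable F := by
  rcases isEmpty_or_nonempty (ℕ → A) with h | ⟨⟨x⟩⟩
  · exact measurable_of_empty F
  have : Nonempty β := ⟨F x⟩
  obtain ⟨G, rfl⟩ := dependsOn_iff_exists_comp.1 hF
  have : Finite (Iio L) := (finite_Iio L)
  exact (measurable_of_finite G).comp (Set.measurable_restrict _)

section IID
variable {Ω A : Type*} [MeasurableSpace Ω] {P : Measure Ω} [IsProbabilityMeasure P]
  [MeasurableSpace A] [MeasurableSingletonClass A] [Finite A] {T : Ω → Ω} {g : Ω → A}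

theorem indepFun_of_dependsOn (hT : Measurable T) (hg : Measurable g)
    (hind : ProbabilityTheory.iIndepFun (fun s ω => g (T^[s] ω)) P)
    {F : (ℕ → A) → ℝ} {L : ℕ} (hF : DependsOn F (Iio L)) {s t : ℕ} (hst : s + L ≤ t) :
    ProbabilityTheory.IndepFun (fun ω => F (itinerary T g (T^[s] ω)))
      (fun ω => F (itinerary T g (T^[t] ω))) P := by
  obtain ⟨ω₀⟩ : Nonempty Ω := nonempty_of_isProbabilityMeasure P
  have hdisj : Disjoint (Finset.Ico s (s + L)) (Finset.Ico t (t + L)) := by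
    rw [Finset.disjoint_left]
    intro i hi hi'
    rw [Finset.mem_Ico] at hi hi'
    omega
  have hfin := hind.indepFun_finset _ _ hdisj (fun i => hg.comp (hT.iterate i))
  let ev : ∀ r : ℕ, ((i : Finset.Ico r (r + L)) → A) → ℝ := fun r u =>
    F fun i => if h : r + i ∈ Finset.Ico r (r + L) then u ⟨r + i, h⟩ else g ω₀
  have hev : ∀ r : ℕ, (fun ω => F (itinerary T g (T^[r] ω))) =
      ev r ∘ fun ω (i : Finset.Ico r (r + L)) => g (T^[i] ω) := by
    intro r
    funext ω
    refine hF fun i hi => ?_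
    rw [itinerary_iterate, dif_pos (Finset.mem_Ico.2 ⟨by omega, by simpa using hi⟩)]
    rfl
  rw [hev s, hev t]
  exact hfin.comp (measurable_of_finite _) (measurable_of_finite _)

theorem ae_tendsto_average_of_dependsOn (hT : MeasurePreserving T P P) (hg : Measurable g)
    (hind : ProbabilityTheory.iIndepFun (fun s ω => g (T^[s] ω)) P)
    {F : (ℕ → A) → ℝ} {L : ℕ} (hF : DependsOn F (Iio L)) {C : ℝ} (hC : ∀ x, |F x| ≤ C) :
    ∀ᵐ ω ∂P, Tendsto (fun n : ℕ => (n : ℝ)⁻¹ *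
      ∑ s ∈ Finset.range n, F (itinerary T g (T^[s] ω))) atTop
        (𝓝 (∫ ω, F (itinerary T g ω) ∂P)) := by
  set L' := L + 1 with hL'
  have hFm : Measurable F := measurable_of_dependsOn_Iio hF
  have hm : Measurable fun ω => F (itinerary T g ω) :=
    hFm.comp (measurable_itinerary hT.measurable hg)
  have hid : ∀ r : ℕ, ProbabilityTheory.IdentDistrib (fun ω => F (itinerary T g (T^[r] ω)))
      (fun ω => F (itinerary T g ω)) P P := fun r =>
    { aemeasurable_fst := (hm.comp (hT.measurable.iterate r)).aemeasurable
      aemeasurable_snd := hm.aemeasurable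
      map_eq := by
        have := Measure.map_map (μ := P) hm (hT.iterate r).measurable
        rw [(hT.iterate r).map_eq] at this
        exact this.symm }
  have hint : Integrable (fun ω => F (itinerary T g ω)) P :=
    Integrable.of_bound hm.aestronglyMeasurable C (ae_of_all _ fun ω => hC _)
  have hres : ∀ c : ℕ, ∀ᵐ ω ∂P, Tendsto (fun n : ℕ => (n : ℝ)⁻¹ *
      ∑ t ∈ Finset.range n, F (itinerary T g (T^[t * L' + c] ω))) atTop
        (𝓝 (∫ ω, F (itinerary T g ω) ∂P)) := by
    intro c
    have := ProbabilityTheory.strong_law_ae (μ := P)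
      (fun t ω => F (itinerary T g (T^[t * L' + c] ω))) ((hid _).integrable_iff.2 hint) ?_
      (fun i => (hid _).trans (hid _).symm)
    · rw [(hid _).integral_eq] at this
      simpa only [smul_eq_mul] using this
    · have hlt : ∀ i j : ℕ, i < j → i * L' + c + L ≤ j * L' + c := by
        intro i j hij
        have : (i + 1) * L' ≤ j * L' := Nat.mul_le_mul_right _ hij
        rw [add_mul] at this
        omega
      intro i j hij
      rcases lt_or_gt_of_ne hij with h | h
      · exact indepFun_of_dependsOn hT.measurable hg hind hF (hlt i j h)
      · exact (indepFun_of_dependsOn hT.measurable hg hind hF (hlt j i h)).symm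
  filter_upwards [ae_all_iff.2 hres] with ω hω
  exact tendsto_average_of_residues (fun s => hC _) (Nat.succ_pos L) fun c _ => hω c

theorem ae_tendsto_average_of_approx (hT : MeasurePreserving T P P) (hg : Measurable g)
    (hind : ProbabilityTheory.iIndepFun (fun s ω => g (T^[s] ω)) P) {ψ : Ω → ℝ}
    (hψ : Measurable ψ)
    (happ : ∀ ε > 0, ∃ (F : (ℕ → A) → ℝ) (L : ℕ) (C : ℝ), DependsOn F (Iio L) ∧
      (∀ x, |F x| ≤ C) ∧ ∀ ω, |ψ ω - F (itinerary T g ω)| ≤ ε) :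
    ∀ᵐ ω ∂P, Tendsto (fun n : ℕ => (n : ℝ)⁻¹ * ∑ s ∈ Finset.range n, ψ (T^[s] ω)) atTop
      (𝓝 (∫ ω, ψ ω ∂P)) := by
  have hpos : ∀ i : ℕ, (0 : ℝ) < 1 / ((i : ℝ) + 1) := fun i => by positivity
  choose F L C hF hC hFψ using fun i : ℕ => happ _ (hpos i)
  have hall := ae_all_iff.2 fun i =>
    ae_tendsto_average_of_dependsOn hT hg hind (hF i) (hC i)
  filter_upwards [hall] with ω hω
  rw [Metric.tendsto_atTop]
  intro ε hε
  obtain ⟨i, hi⟩ := exists_nat_one_div_lt (by positivity : 0 < ε / 3)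
  obtain ⟨N, hN⟩ := Metric.tendsto_atTop.1 (hω i) (ε / 3) (by positivity)
  refine ⟨max N 1, fun n hn => ?_⟩
  have h1 := hN n (le_of_max_le_left hn)
  have hn0 : (0 : ℝ) < n := by exact_mod_cast (le_of_max_le_right hn)
  rw [Real.dist_eq] at h1 ⊢
  have hFm : Measurable fun ω => F i (itinerary T g ω) :=
    (measurable_of_dependsOn_Iio (hF i)).comp (measurable_itinerary hT.measurable hg)
  have hint : Integrable (fun ω => F i (itinerary T g ω)) P :=
    Integrable.of_bound hFm.aestronglyMeasurable (C i) (ae_of_all _ fun ω => hC i _)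
  have hdint : Integrable (fun ω => ψ ω - F i (itinerary T g ω)) P :=
    Integrable.of_bound (hψ.sub hFm).aestronglyMeasurable _ (ae_of_all _ fun ω => hFψ i ω)
  have hψint : Integrable ψ P := by
    have := hdint.add hint
    refine this.congr (ae_of_all _ fun ω => ?_)
    simp
  have h2 : |∫ ω, ψ ω ∂P - ∫ ω, F i (itinerary T g ω) ∂P| ≤ 1 / ((i : ℝ) + 1) := by
    rw [← integral_sub hψint hint]
    have := norm_integral_le_of_norm_le_const (μ := P)
      (f := fun ω => ψ ω - F i (itinerary T g ω)) (ae_of_all _ fun ω => hFψ i ω)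
    simpa using this
  have h3 : |(n : ℝ)⁻¹ * ∑ s ∈ Finset.range n, ψ (T^[s] ω) -
      (n : ℝ)⁻¹ * ∑ s ∈ Finset.range n, F i (itinerary T g (T^[s] ω))| ≤ 1 / ((i : ℝ) + 1) := by
    rw [← mul_sub, ← Finset.sum_sub_distrib, abs_mul, abs_of_pos (inv_pos.2 hn0),
      inv_mul_le_iff₀ hn0]
    refine (Finset.abs_sum_le_sum_abs _ _).trans
      ((Finset.sum_le_sum fun s _ => hFψ i (T^[s] ω)).trans ?_)
    simp
  rw [abs_lt] at h1 ⊢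
  rw [abs_le] at h2 h3
  constructor <;> linarith [h1.1, h1.2, h2.1, h2.2, h3.1, h3.2]

end IID

theorem iIndepFun_of_measure_word_eq_prod {Ω A : Type*} [MeasurableSpace Ω] {P : Measure Ω}
    [MeasurableSpace A] [MeasurableSingletonClass A] [Fintype A]
    {X : ℕ → Ω → A} (hX : ∀ i, Measurable (X i)) {q : A → ℝ≥0∞} (hq : ∑ a, q a = 1)
    (hP : ∀ (n : ℕ) (w : Fin n → A), P {ω | ∀ i : Fin n, X i ω = w i} = ∏ i, q (w i)) :
    ProbabilityTheory.iIndepFun X P := by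
  classical
  have key : ∀ (n : ℕ) (t : ℕ → Finset A),
      P {ω | ∀ i : Fin n, X i ω ∈ t i} = ∏ i ∈ Finset.range n, ∑ a ∈ t i, q a := by
    intro n t
    have hU : {ω | ∀ i : Fin n, X i ω ∈ t i} =
        ⋃ w ∈ Fintype.piFinset (fun i : Fin n => t i), {ω | ∀ i : Fin n, X i ω = w i} := by
      ext ω
      simp only [mem_ofPred_eq, mem_iUnion, Fintype.mem_piFinset, exists_prop]
      refine ⟨fun h => ⟨fun i => X i ω, h, fun _ => rfl⟩, ?_⟩
      rintro ⟨w, hw, h⟩ i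
      rw [h i]
      exact hw i
    rw [hU, measure_biUnion_finset, Finset.sum_congr rfl fun w _ => hP n w,
      ← Finset.prod_univ_sum, Finset.prod_range fun i => ∑ a ∈ t i, q a]
    · intro w _ w' _ hww'
      rw [Function.onFun, Set.disjoint_left]
      intro ω h h'
      exact hww' (funext fun i => (h i).symm.trans (h' i))
    · intro w _
      have : {ω | ∀ i : Fin n, X i ω = w i} = ⋂ i : Fin n, X i ⁻¹' {w i} := by
        ext ω
        simp
      rw [this]
      exact MeasurableSet.iInter fun i => hX i (measurableSet_singleton _)
  have key' : ∀ (S : Finset ℕ) (t : ℕ → Set A),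
      P (⋂ i ∈ S, X i ⁻¹' t i) = ∏ i ∈ S, ∑ a ∈ (t i).toFinset, q a := by
    intro S t
    have h := key (S.sup id + 1) fun i => if i ∈ S then (t i).toFinset else Finset.univ
    have hS : S ⊆ Finset.range (S.sup id + 1) := fun i hi =>
      Finset.mem_range_succ_iff.2 (Finset.le_sup (f := id) hi)
    have h1 : ⋂ i ∈ S, X i ⁻¹' t i = {ω | ∀ i : Fin (S.sup id + 1),
        X i ω ∈ (if (i : ℕ) ∈ S then (t i).toFinset else Finset.univ : Finset A)} := by
      ext ω
      simp only [mem_iInter, mem_preimage, mem_ofPred_eq]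
      constructor
      · intro hω i
        split_ifs with hi
        · simpa using hω i hi
        · exact Finset.mem_univ _
      · intro hω i hi
        have := hω ⟨i, Finset.mem_range.1 (hS hi)⟩
        simpa [hi] using this
    rw [h1, h]
    rw [← Finset.prod_subset hS fun i _ hi => by simp [hi, hq]]
    exact Finset.prod_congr rfl fun i hi => by simp [hi]
  rw [ProbabilityTheory.iIndepFun_iff_measure_inter_preimage_eq_mul]
  intro S t _
  rw [key']
  refine Finset.prod_congr rfl fun i _ => ?_
  have := key' {i} t
  simpa using this.symm

theorem shiftMap_iterate_apply {β : Type*} (r n : ℕ) (ω : ℕ → β) :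
    (shiftMap^[r] ω) n = ω (n + r) := by
  induction r generalizing ω with
  | zero => rfl
  | succ r ih => rw [Function.iterate_succ_apply, ih, shiftMap]; congr 1

theorem shiftMap_iterate_iterate_apply {β : Type*} (k s n : ℕ) (ω : ℕ → β) :
    ((shiftMap^[k])^[s] ω) n = ω (s * k + n) := by
  rw [← Function.iterate_mul, shiftMap_iterate_apply, mul_comm, add_comm]

/-- The initial word of length `k`. -/
def firstBlock {β : Type*} (k : ℕ) (ω : ℕ → β) : Fin k → β := fun i => ω i

theorem firstBlock_iterate {β : Type*} (k s : ℕ) (ω : ℕ → β) (i : Fin k) :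
    firstBlock k ((shiftMap^[k])^[s] ω) i = ω (s * k + i) :=
  shiftMap_iterate_iterate_apply _ _ _ _

theorem measurable_shiftMap {β : Type*} [MeasurableSpace β] :
    Measurable (shiftMap : (ℕ → β) → ℕ → β) :=
  measurable_pi_lambda _ fun n => measurable_pi_apply (n + 1)

theorem continuous_shiftMap {β : Type*} [TopologicalSpace β] :
    Continuous (shiftMap : (ℕ → β) → ℕ → β) :=
  continuous_pi fun n => continuous_apply (n + 1)

theorem measurable_firstBlock {β : Type*} [MeasurableSpace β] (k : ℕ) :
    Measurable (firstBlock k : (ℕ → β) → Fin k → β) :=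
  measurable_pi_lambda _ fun i => measurable_pi_apply (i : ℕ)

theorem IsBernoulliBlock.iIndepFun {β : Type*} [MeasurableSpace β] [MeasurableSingletonClass β]
    [Fintype β] {k : ℕ} (hk : 0 < k) {ν : Measure (ℕ → β)} (hν : IsBernoulliBlock k ν) :
    ProbabilityTheory.iIndepFun (fun s ω => firstBlock k ((shiftMap^[k])^[s] ω)) ν := by
  classical
  obtain ⟨p, hp, hpν⟩ := hν
  refine iIndepFun_of_measure_word_eq_prod (q := p)
    (fun s => (measurable_firstBlock k).comp ((measurable_shiftMap.iterate k).iterate s))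
    hp fun n w => ?_
  have hdiv : ∀ i : Fin (n * k), i.1 / k < n := fun i =>
    Nat.div_lt_of_lt_mul (mul_comm n k ▸ i.2)
  have h := hpν n fun i => w ⟨i.1 / k, hdiv i⟩ ⟨i.1 % k, Nat.mod_lt _ hk⟩
  have hw : ∀ r : Fin n, (fun i : Fin k => w ⟨(blockIdx r i).1 / k, hdiv _⟩
      ⟨(blockIdx r i).1 % k, Nat.mod_lt _ hk⟩) = w r := by
    intro r
    funext i
    have h1 : (r.1 * k + i.1) / k = r.1 := by
      rw [mul_comm, Nat.mul_add_div hk, Nat.div_eq_of_lt i.2, add_zero]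
    have h2 : (r.1 * k + i.1) % k = i.1 := by
      rw [mul_comm, Nat.mul_add_mod, Nat.mod_eq_of_lt i.2]
    simp only [blockIdx, h1, h2]
  simp only [hw] at h
  rw [← h]
  congr 1
  ext ω
  simp only [cylinderSet, mem_ofPred_eq]
  constructor
  · intro hω i
    have := congrFun (hω ⟨i.1 / k, hdiv i⟩) ⟨i.1 % k, Nat.mod_lt _ hk⟩
    rwa [firstBlock_iterate, Nat.div_add_mod'] at this
  · intro hω r
    rw [← hw r]
    funext i
    rw [firstBlock_iterate]
    exact hω (blockIdx r i)

/-- Gibbs' inequality for a joint distribution `Q` and a subprobability kernel `K`. -/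
theorem sum_negMulLog_le_of_kernel {ι κ : Type*} [Fintype ι] [Fintype κ] {Q K : ι → κ → ℝ}
    (hQ : ∀ u v, 0 ≤ Q u v) (hQ1 : ∑ u, ∑ v, Q u v = 1) (hK : ∀ u v, 0 < K u v)
    (hK1 : ∀ v, ∑ u, K u v ≤ 1) :
    ∑ u, Real.negMulLog (∑ v, Q u v) ≤
      ∑ v, Real.negMulLog (∑ u, Q u v) + ∑ u, ∑ v, Q u v * -Real.log (K u v) := by
  have hterm : ∀ u v, Q u v * -Real.log (∑ v', Q u v') ≤
      Q u v * -Real.log (∑ u', Q u' v) + Q u v * -Real.log (K u v) +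
        ((∑ u', Q u' v) * K u v - Q u v) := by
    intro u v
    have hA : Q u v ≤ ∑ v', Q u v' :=
      Finset.single_le_sum (f := fun v' => Q u v') (fun v' _ => hQ u v') (Finset.mem_univ v)
    have hB : Q u v ≤ ∑ u', Q u' v :=
      Finset.single_le_sum (f := fun u' => Q u' v) (fun u' _ => hQ u' v) (Finset.mem_univ u)
    set a := ∑ v', Q u v'
    set b := ∑ u', Q u' v
    rcases (hQ u v).eq_or_lt with h0 | h0
    · rw [← h0] at hB ⊢
      have := mul_nonneg hB (hK u v).le
      linarith
    have ha : 0 < a := h0.trans_le hA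
    have hb : 0 < b := h0.trans_le hB
    have hlog := Real.log_le_sub_one_of_pos (div_pos (mul_pos hb (hK u v)) ha)
    rw [Real.log_div (mul_pos hb (hK u v)).ne' ha.ne', Real.log_mul hb.ne' (hK u v).ne'] at hlog
    have h1 := mul_le_mul_of_nonneg_left hlog h0.le
    have h2 : Q u v * (b * K u v / a) ≤ b * K u v := by
      rw [mul_div_assoc', div_le_iff₀ ha, mul_comm]
      exact mul_le_mul_of_nonneg_left hA (mul_pos hb (hK u v)).le
    linarith
  have hsum := Finset.sum_le_sum fun u (_ : u ∈ Finset.univ) =>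
    Finset.sum_le_sum fun v (_ : v ∈ Finset.univ) => hterm u v
  simp only [Finset.sum_add_distrib, Finset.sum_sub_distrib] at hsum
  have hA : ∑ u, ∑ v, Q u v * -Real.log (∑ v', Q u v') =
      ∑ u, Real.negMulLog (∑ v, Q u v) := by
    refine Finset.sum_congr rfl fun u _ => ?_
    rw [← Finset.sum_mul, Real.negMulLog]
    ring
  have hB : ∑ u, ∑ v, Q u v * -Real.log (∑ u', Q u' v) =
      ∑ v, Real.negMulLog (∑ u, Q u v) := by
    rw [Finset.sum_comm]
    refine Finset.sum_congr rfl fun v _ => ?_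
    rw [← Finset.sum_mul, Real.negMulLog]
    ring
  have hC : ∑ u, ∑ v, (∑ u', Q u' v) * K u v ≤ 1 := by
    rw [Finset.sum_comm, ← hQ1, Finset.sum_comm (f := Q)]
    refine Finset.sum_le_sum fun v _ => ?_
    rw [← Finset.mul_sum]
    exact mul_le_of_le_one_right (Finset.sum_nonneg fun u _ => hQ u v) (hK1 v)
  rw [hA, hB, hQ1] at hsum
  linarith

theorem sum_negMulLog_prod {A : Type*} [Fintype A] {q : A → ℝ} (hq : ∑ a, q a = 1) (n : ℕ) :
    ∑ w : Fin n → A, Real.negMulLog (∏ i, q (w i)) = n * ∑ a, Real.negMulLog (q a) := by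
  have hone : ∀ n : ℕ, ∑ w : Fin n → A, ∏ i, q (w i) = 1 := fun n => by
    classical
    have := Finset.prod_univ_sum (fun _ : Fin n => (Finset.univ : Finset A)) fun _ a => q a
    rw [Fintype.piFinset_univ] at this
    rw [← this]
    simp [hq]
  induction n with
  | zero => simp
  | succ n ih =>
    rw [← (Fin.consEquiv fun _ => A).sum_comp, Fintype.sum_prod_type]
    simp only [Fin.consEquiv_apply, Fin.prod_univ_succ, Fin.cons_zero, Fin.cons_succ,
      Real.negMulLog_mul, Finset.sum_add_distrib, ← Finset.sum_mul, ← Finset.mul_sum, hone, ih,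
      hq]
    push_cast
    ring

section Entropy
variable {Ω : Type*} [MeasurableSpace Ω] {P : Measure Ω} [IsProbabilityMeasure P]

theorem entPart_nonneg {ι : Type*} [Fintype ι] (U : Ω → ι) : 0 ≤ entPart P U :=
  Finset.sum_nonneg fun _ _ => Real.negMulLog_nonneg measureReal_nonneg measureReal_le_one

theorem entPart_le_add_integral {ι κ : Type*} [Fintype ι] [MeasurableSpace ι]
    [MeasurableSingletonClass ι] [Fintype κ] [MeasurableSpace κ] [MeasurableSingletonClass κ]
    {U : Ω → ι} {V : Ω → κ} (hU : Measurable U) (hV : Measurable V) {K : ι → κ → ℝ}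
    (hK : ∀ u v, 0 < K u v) (hK1 : ∀ v, ∑ u, K u v ≤ 1) :
    entPart P U ≤ entPart P V + ∫ ω, -Real.log (K (U ω) (V ω)) ∂P := by
  have hUs : ∀ u, MeasurableSet (U ⁻¹' {u}) := fun u => hU (measurableSet_singleton u)
  have hVs : ∀ v, MeasurableSet (V ⁻¹' {v}) := fun v => hV (measurableSet_singleton v)
  have hsumV : ∀ u, ∑ v, P.real (U ⁻¹' {u} ∩ V ⁻¹' {v}) = P.real (U ⁻¹' {u}) := by
    intro u
    have := sum_measureReal_preimage_singleton (μ := P.restrict (U ⁻¹' {u})) Finset.univ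
      (f := V) (fun v _ => hVs v)
    simp only [measureReal_restrict_apply (hVs _)] at this
    simpa [inter_comm] using this
  have hsumU : ∀ v, ∑ u, P.real (U ⁻¹' {u} ∩ V ⁻¹' {v}) = P.real (V ⁻¹' {v}) := by
    intro v
    have := sum_measureReal_preimage_singleton (μ := P.restrict (V ⁻¹' {v})) Finset.univ
      (f := U) (fun u _ => hUs u)
    simp only [measureReal_restrict_apply (hUs _)] at this
    simpa using this
  have htot : ∑ u, P.real (U ⁻¹' {u}) = 1 := by
    have := sum_measureReal_preimage_singleton (μ := P) Finset.univ (f := U) (fun u _ => hUs u)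
    simpa using this
  have hint : ∫ ω, -Real.log (K (U ω) (V ω)) ∂P =
      ∑ u, ∑ v, P.real (U ⁻¹' {u} ∩ V ⁻¹' {v}) * -Real.log (K u v) := by
    have hUV : Measurable fun ω => (U ω, V ω) := hU.prodMk hV
    have : IsProbabilityMeasure (P.map fun ω => (U ω, V ω)) :=
      Measure.isProbabilityMeasure_map hUV.aemeasurable
    rw [← integral_map (φ := fun ω => (U ω, V ω)) (f := fun x => -Real.log (K x.1 x.2))
      hUV.aemeasurable (measurable_of_finite _).aestronglyMeasurable,
      integral_fintype (.of_finite), Fintype.sum_prod_type]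
    refine Finset.sum_congr rfl fun u _ => Finset.sum_congr rfl fun v _ => ?_
    rw [map_measureReal_apply hUV (measurableSet_singleton _), smul_eq_mul,
      ← singleton_prod_singleton, mk_preimage_prod]
  have h := sum_negMulLog_le_of_kernel (Q := fun u v => P.real (U ⁻¹' {u} ∩ V ⁻¹' {v}))
    (fun _ _ => measureReal_nonneg) (by simp only [hsumV, htot]) hK hK1
  simp only [hsumV, hsumU] at h
  rw [hint]
  exact h

end Entropy

theorem exists_dependsOn_measureReal_ne_le {A : Type*} [MeasurableSpace A] {m : ℕ}
    (μ : Measure (ℕ → A)) [IsProbabilityMeasure μ] {p : (ℕ → A) → Fin m} (hp : Measurable p)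
    {e : ℝ} (he : 0 < e) :
    ∃ (L : ℕ) (F : (ℕ → A) → Fin m), DependsOn F (Iio L) ∧ μ.real {x | p x ≠ F x} ≤ e := by
  classical
  obtain ⟨x₀⟩ : Nonempty (ℕ → A) := nonempty_of_isProbabilityMeasure μ
  have hdense := Measure.MeasureDense.of_generateFrom_isSetAlgebra_finite (μ := μ)
    isSetAlgebra_measurableCylinders generateFrom_measurableCylinders.symm
  have he' : 0 < e / (m + 1) := by positivity
  choose S hS hSμ using fun b : Fin m => hdense.approx (p ⁻¹' {b})
    (hp (measurableSet_singleton b)) (measure_ne_top _ _) _ he'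
  have hSN : ∀ b, ∃ N, ∀ x y : ℕ → A, (∀ i ≤ N, x i = y i) → (x ∈ S b ↔ y ∈ S b) := by
    intro b
    have := hS b
    rw [measurableCylinders_nat] at this
    simp only [mem_iUnion, mem_singleton_iff, exists_prop] at this
    obtain ⟨N, S', -, hS'⟩ := this
    refine ⟨N, fun x y hxy => ?_⟩
    rw [hS', mem_cylinder, mem_cylinder]
    have : (Finset.Iic N).restrict x = (Finset.Iic N).restrict y :=
      funext fun i => hxy i (Finset.mem_Iic.1 i.2)
    rw [this]
  choose N hN using hSN
  let G : Set (Fin m) → Fin m := fun s => if h : s.Nonempty then h.some else p x₀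
  refine ⟨Finset.univ.sup N + 1, fun x => G {b | x ∈ S b}, ?_, ?_⟩
  · intro x y hxy
    have : {b | x ∈ S b} = {b | y ∈ S b} := by
      ext b
      exact hN b x y fun i hi => hxy i
        (Nat.lt_succ_of_le (hi.trans (Finset.le_sup (Finset.mem_univ b))))
    simp only [this]
  · have hsub : {x | p x ≠ G {b | x ∈ S b}} ⊆ ⋃ b ∈ Finset.univ, symmDiff (p ⁻¹' {b}) (S b) := by
      intro x hx
      simp only [mem_iUnion, Finset.mem_univ, exists_prop, true_and]
      by_cases h : x ∈ S (p x)
      · have hne : {b | x ∈ S b}.Nonempty := ⟨_, h⟩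
        have hG : G {b | x ∈ S b} = hne.some := dif_pos hne
        refine ⟨hne.some, Or.inr ⟨hne.some_mem, fun hmem => hx ?_⟩⟩
        rw [hG]
        exact hmem
      · exact ⟨p x, Or.inl ⟨rfl, h⟩⟩
    refine (measureReal_mono hsub (measure_ne_top _ _)).trans ((measureReal_biUnion_finset_le _ _).trans ?_)
    have hb : ∀ b ∈ (Finset.univ : Finset (Fin m)),
        μ.real (symmDiff (p ⁻¹' {b}) (S b)) ≤ e / (m + 1) := fun b _ =>
      ENNReal.toReal_le_of_le_ofReal he'.le (hSμ b).le
    refine (Finset.sum_le_sum hb).trans ?_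
    rw [Finset.sum_const, Finset.card_univ, Fintype.card_fin, nsmul_eq_mul, mul_div_assoc',
      div_le_iff₀ (by positivity)]
    nlinarith

theorem measureReal_word_eq_prod {Ω A : Type*} [MeasurableSpace Ω] {P : Measure Ω}
    [MeasurableSpace A] [MeasurableSingletonClass A] {T : Ω → Ω} {g : Ω → A}
    (hT : MeasurePreserving T P P) (hg : Measurable g)
    (hind : ProbabilityTheory.iIndepFun (fun s ω => g (T^[s] ω)) P) (n : ℕ) (w : Fin n → A) :
    P.real {ω | ∀ i : Fin n, g (T^[i] ω) = w i} = ∏ i, P.real (g ⁻¹' {w i}) := by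
  have hfin : ProbabilityTheory.iIndepFun (fun (i : Fin n) ω => g (T^[i] ω)) P :=
    hind.precomp Fin.val_injective
  have h := hfin.measure_inter_preimage_eq_mul Finset.univ (sets := fun i => {w i})
    fun i _ => measurableSet_singleton _
  have hset : {ω | ∀ i : Fin n, g (T^[i] ω) = w i} =
      ⋂ i ∈ Finset.univ, (fun ω => g (T^[(i : Fin n)] ω)) ⁻¹' {w i} := by
    ext ω
    simp
  rw [hset, measureReal_def, h, ENNReal.toReal_prod]
  refine Finset.prod_congr rfl fun i _ => ?_
  have := (hT.iterate i).measure_preimage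
    (hg (measurableSet_singleton (w i))).nullMeasurableSet
  rw [measureReal_def, ← this]
  rfl

section IID
variable {Ω A : Type*} [MeasurableSpace Ω] {P : Measure Ω} [IsProbabilityMeasure P]
  [MeasurableSpace A] [MeasurableSingletonClass A] [Fintype A] {T : Ω → Ω} {g : Ω → A}

theorem entPart_word (hT : MeasurePreserving T P P) (hg : Measurable g)
    (hind : ProbabilityTheory.iIndepFun (fun s ω => g (T^[s] ω)) P) (n : ℕ) :
    entPart P (fun ω (i : Fin n) => g (T^[i] ω)) = n * entPart P g := by
  have hq : ∑ a, P.real (g ⁻¹' {a}) = 1 := by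
    have := sum_measureReal_preimage_singleton (μ := P) Finset.univ (f := g)
      (fun a _ => hg (measurableSet_singleton a))
    simpa using this
  have h := sum_negMulLog_prod hq n
  rw [show entPart P g = ∑ a, Real.negMulLog (P.real (g ⁻¹' {a})) from rfl, ← h]
  refine Finset.sum_congr rfl fun w _ => ?_
  rw [← measureReal_word_eq_prod hT hg hind]
  congr 2
  congr 1
  ext ω
  simp [funext_iff]

/-- The noisy channel on `m` letters that keeps a letter with weight `1 - η` and moves it to any
given letter with weight `η / m`. -/
def noise (m : ℕ) (η : ℝ) (b z : Fin m) : ℝ := if b = z then 1 - η else η / m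

theorem noise_pos {m : ℕ} {η : ℝ} (h0 : 0 < η) (h1 : η < 1) (b z : Fin m) :
    0 < noise m η b z := by
  have : (0 : ℝ) < m := by exact_mod_cast b.pos
  unfold noise
  split_ifs
  · linarith
  · positivity

theorem sum_noise_le {m : ℕ} {η : ℝ} (h0 : 0 < η) (z : Fin m) :
    ∑ b, noise m η b z ≤ 1 := by
  have hm : (0 : ℝ) < m := by exact_mod_cast z.pos
  have h : ∀ b, noise m η b z ≤ (if b = z then 1 - η else 0) + η / m := by
    intro b
    unfold noise
    have : 0 ≤ η / m := by positivity
    split_ifs <;> linarith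
  refine (Finset.sum_le_sum fun b _ => h b).trans ?_
  rw [Finset.sum_add_distrib, Finset.sum_ite_eq' Finset.univ z, if_pos (Finset.mem_univ z),
    Finset.sum_const, Finset.card_univ, Fintype.card_fin, nsmul_eq_mul, mul_div_cancel₀ _ hm.ne']
  linarith

theorem entPart_iterate_le (hT : MeasurePreserving T P P) (hg : Measurable g)
    (hind : ProbabilityTheory.iIndepFun (fun s ω => g (T^[s] ω)) P) {m : ℕ} {Y : Ω → Fin m}
    (hY : Measurable Y) {F : (ℕ → A) → Fin m} {L : ℕ} (hF : DependsOn F (Iio L)) {η : ℝ}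
    (h0 : 0 < η) (h1 : η < 1) (n : ℕ) :
    entPart P (fun ω (i : Fin n) => Y (T^[i] ω)) ≤ (n + L : ℕ) * entPart P g +
      n * ∫ ω, -Real.log (noise m η (Y ω) (F (itinerary T g ω))) ∂P := by
  obtain ⟨ω₀⟩ : Nonempty Ω := nonempty_of_isProbabilityMeasure P
  let ext : (Fin (n + L) → A) → ℕ → A := fun w t => if h : t < n + L then w ⟨t, h⟩ else g ω₀
  let z : (Fin (n + L) → A) → Fin n → Fin m := fun w i => F fun t => ext w (i + t)
  have hTm := hT.measurable
  have hle := entPart_le_add_integral (P := P) (U := fun ω (i : Fin n) => Y (T^[i] ω))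
    (V := fun ω (i : Fin (n + L)) => g (T^[i] ω))
    (measurable_pi_lambda _ fun i => hY.comp (hTm.iterate i))
    (measurable_pi_lambda _ fun i => hg.comp (hTm.iterate i))
    (K := fun y w => ∏ i, noise m η (y i) (z w i))
    (fun y w => Finset.prod_pos fun i _ => noise_pos h0 h1 _ _) fun w => by
      classical
      have := Finset.prod_univ_sum (fun _ : Fin n => (Finset.univ : Finset (Fin m)))
        fun i b => noise m η b (z w i)
      rw [Fintype.piFinset_univ] at this
      rw [← this]
      exact Finset.prod_le_one
        (fun i _ => Finset.sum_nonneg fun b _ => (noise_pos h0 h1 _ _).le)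
        fun i _ => sum_noise_le h0 _
  rw [entPart_word hT hg hind] at hle
  refine hle.trans_eq ?_
  congr 1
  set c : Ω → ℝ := fun ω => -Real.log (noise m η (Y ω) (F (itinerary T g ω))) with hc
  have hcm : Measurable c := by
    have hF' : Measurable fun ω => F (itinerary T g ω) :=
      (measurable_of_dependsOn_Iio hF).comp (measurable_itinerary hTm hg)
    exact (measurable_of_finite fun x : Fin m × Fin m => -Real.log (noise m η x.1 x.2)).comp
      (hY.prodMk hF')
  have hci : ∀ i : ℕ, Integrable (fun ω => c (T^[i] ω)) P := by
    intro i
    refine Integrable.of_bound (hcm.comp (hTm.iterate i)).aestronglyMeasurable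
      (∑ b, ∑ z', ‖-Real.log (noise m η b z')‖) (ae_of_all _ fun ω => ?_)
    refine le_trans ?_ (Finset.single_le_sum (f := fun b =>
      ∑ z', ‖-Real.log (noise m η b z')‖) (fun b _ => by positivity)
      (Finset.mem_univ (Y (T^[i] ω))))
    exact Finset.single_le_sum (f := fun z' => ‖-Real.log (noise m η (Y (T^[i] ω)) z')‖)
      (fun b _ => by positivity) (Finset.mem_univ (F (itinerary T g (T^[i] ω))))
  have hsum : ∀ ω, -Real.log (∏ i : Fin n, noise m η (Y (T^[i] ω))
      (z (fun i : Fin (n + L) => g (T^[i] ω)) i)) = ∑ i : Fin n, c (T^[i] ω) := by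
    intro ω
    rw [Real.log_prod fun i _ => (noise_pos h0 h1 _ _).ne', ← Finset.sum_neg_distrib]
    refine Finset.sum_congr rfl fun i _ => ?_
    have : z (fun i : Fin (n + L) => g (T^[i] ω)) i = F (itinerary T g (T^[i] ω)) := by
      refine hF fun t ht => ?_
      have hlt : (i : ℕ) + t < n + L := by
        have := i.2
        have := mem_Iio.1 ht
        omega
      rw [itinerary_iterate]
      simp only [ext, dif_pos hlt, itinerary]
    rw [this]
  simp only [hsum]
  rw [integral_finsetSum _ fun (i : Fin n) _ => hci i]
  have hconst : ∀ i : ℕ, ∫ ω, c (T^[i] ω) ∂P = ∫ ω, c ω ∂P := by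
    intro i
    have := integral_map (μ := P) (φ := T^[i]) (f := c) (hTm.iterate i).aemeasurable
      hcm.aestronglyMeasurable
    rw [(hT.iterate i).map_eq] at this
    exact this.symm
  simp [hconst]

theorem integral_noise_le (hT : Measurable T) (hg : Measurable g) {m : ℕ} {Y : Ω → Fin m}
    (hY : Measurable Y) {F : (ℕ → A) → Fin m} {L : ℕ} (hF : DependsOn F (Iio L)) {η : ℝ}
    (h0 : 0 < η) (h1 : η < 1) :
    ∫ ω, -Real.log (noise m η (Y ω) (F (itinerary T g ω))) ∂P ≤
      -Real.log (1 - η) + P.real {ω | Y ω ≠ F (itinerary T g ω)} * |Real.log (η / m)| := by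
  have hF' : Measurable fun ω => F (itinerary T g ω) :=
    (measurable_of_dependsOn_Iio hF).comp (measurable_itinerary hT hg)
  set B := {ω | Y ω ≠ F (itinerary T g ω)} with hB
  have hBm : MeasurableSet B := (measurableSet_eq_fun hY hF').compl
  have hi : Integrable (fun ω => -Real.log (1 - η) +
      B.indicator (fun _ => |Real.log (η / m)|) ω) P :=
    (integrable_const _).add ((integrable_const _).indicator hBm)
  refine (integral_mono_of_nonneg (ae_of_all _ fun ω => ?_) hi (ae_of_all _ fun ω => ?_)).trans ?_
  · have : noise m η (Y ω) (F (itinerary T g ω)) ≤ 1 :=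
      (Finset.single_le_sum (f := fun b => noise m η b (F (itinerary T g ω)))
        (fun b _ => (noise_pos h0 h1 _ _).le) (Finset.mem_univ _)).trans (sum_noise_le h0 _)
    have := Real.log_nonpos (noise_pos h0 h1 _ _).le this
    simpa using this
  · have hlog : Real.log (1 - η) ≤ 0 := Real.log_nonpos (by linarith) (by linarith)
    by_cases h : Y ω = F (itinerary T g ω)
    · have hω : ω ∉ B := fun h' => h' h
      simp [noise, h, indicator_of_notMem hω]
    · have hω : ω ∈ B := h
      simp only [noise, if_neg h, indicator_of_mem hω]
      linarith [neg_le_abs (Real.log (η / m))]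
  · rw [integral_add (integrable_const _) ((integrable_const _).indicator hBm),
      integral_indicator_const _ hBm]
    simp

/-- **Kolmogorov–Sinai**: no partition has larger dynamical entropy than a generating
independent one. -/
theorem iInf_entPart_le (hT : MeasurePreserving T P P) (hg : Measurable g)
    (hind : ProbabilityTheory.iIndepFun (fun s ω => g (T^[s] ω)) P) {m : ℕ}
    {p : (ℕ → A) → Fin m} (hp : Measurable p) :
    ⨅ n : ℕ, ((n : ℝ) + 1)⁻¹ *
      entPart P (fun ω (i : Fin (n + 1)) => p (itinerary T g (T^[i] ω))) ≤ entPart P g := by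
  have hit := measurable_itinerary hT.measurable hg
  have hbdd : BddBelow (range fun n : ℕ => ((n : ℝ) + 1)⁻¹ *
      entPart P (fun ω (i : Fin (n + 1)) => p (itinerary T g (T^[i] ω)))) := by
    refine ⟨0, ?_⟩
    rintro _ ⟨n, rfl⟩
    have := entPart_nonneg (P := P)
      (fun ω (i : Fin (n + 1)) => p (itinerary T g (T^[i] ω)))
    positivity
  refine le_of_forall_pos_le_add fun θ hθ => ?_
  set η := 1 - Real.exp (-(θ / 2)) with hη
  have h0 : 0 < η := by
    have : Real.exp (-(θ / 2)) < 1 := by rw [Real.exp_lt_one_iff]; linarith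
    linarith
  have h1 : η < 1 := by linarith [Real.exp_pos (-(θ / 2))]
  have hlogη : -Real.log (1 - η) = θ / 2 := by simp [hη]
  have : IsProbabilityMeasure (P.map (itinerary T g)) :=
    Measure.isProbabilityMeasure_map hit.aemeasurable
  set M := |Real.log (η / m)| + 1
  have hM : 0 < M := by positivity
  obtain ⟨L, F, hF, hFp⟩ := exists_dependsOn_measureReal_ne_le (P.map (itinerary T g)) hp
    (div_pos (half_pos hθ) hM)
  have hFm : Measurable F := measurable_of_dependsOn_Iio hF
  have hne : MeasurableSet {x | p x ≠ F x} := (measurableSet_eq_fun hp hFm).compl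
  rw [map_measureReal_apply hit hne] at hFp
  have hκ := integral_noise_le (P := P) hT.measurable hg (hp.comp hit) hF h0 h1
  set κ := ∫ ω, -Real.log (noise m η ((p ∘ itinerary T g) ω) (F (itinerary T g ω))) ∂P
  have hκθ : κ ≤ θ := by
    have h2 : P.real {ω | (p ∘ itinerary T g) ω ≠ F (itinerary T g ω)} *
        |Real.log (η / m)| ≤ θ / 2 / M * M :=
      mul_le_mul hFp (by simp [M]) (abs_nonneg _) (by positivity)
    rw [div_mul_cancel₀ _ hM.ne'] at h2
    linarith
  have hlim : Tendsto (fun n : ℕ => entPart P g + 1 / ((n : ℝ) + 1) * (L * entPart P g) + θ)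
      atTop (𝓝 (entPart P g + 0 * (L * entPart P g) + θ)) :=
    ((tendsto_one_div_add_atTop_nhds_zero_nat.mul_const _).const_add _).add_const _
  rw [zero_mul, add_zero] at hlim
  refine ge_of_tendsto' hlim fun n => (ciInf_le hbdd n).trans ?_
  have hn := entPart_iterate_le hT hg hind (hp.comp hit) hF h0 h1 (n + 1)
  have hpos : (0 : ℝ) < (n : ℝ) + 1 := by positivity
  rw [inv_mul_le_iff₀ hpos]
  refine hn.trans ?_
  have h3 : ((n : ℝ) + 1) * κ ≤ (n + 1) * θ := mul_le_mul_of_nonneg_left hκθ hpos.le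
  push_cast
  calc _ ≤ ((n : ℝ) + 1 + L) * entPart P g + (n + 1) * θ := by linarith
    _ = _ := by field_simp

end IID

theorem exists_forall_abs_sub_le_of_continuous {β : Type*} [Finite β] [TopologicalSpace β]
    [DiscreteTopology β] {ψ : (ℕ → β) → ℝ} (hψ : Continuous ψ) {ε : ℝ} (hε : 0 < ε) :
    ∃ L : ℕ, ∀ x y : ℕ → β, (∀ i < L, x i = y i) → |ψ x - ψ y| ≤ ε := by
  let _ : MetricSpace (ℕ → β) := PiNat.metricSpace
  obtain ⟨δ, hδ, h⟩ := Metric.uniformContinuous_iff.1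
    (CompactSpace.uniformContinuous_of_continuous hψ) ε hε
  obtain ⟨L, hL⟩ := exists_pow_lt_of_lt_one hδ (by norm_num : (1 / 2 : ℝ) < 1)
  exact ⟨L, fun x y hxy => (h ((PiNat.mem_cylinder_iff_dist_le.1 hxy).trans_lt hL)).le⟩

/-- Concatenate a sequence of words of length `k`. -/
def concatBlocks {β : Type*} {k : ℕ} (hk : 0 < k) (x : ℕ → Fin k → β) : ℕ → β :=
  fun n => x (n / k) ⟨n % k, Nat.mod_lt _ hk⟩

theorem concatBlocks_itinerary {β β' : Type*} {k : ℕ} (hk : 0 < k) (f : β → β') (ω : ℕ → β) :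
    concatBlocks hk (itinerary (shiftMap^[k]) (fun ω i => f (firstBlock k ω i)) ω) =
      fun n => f (ω n) := by
  funext n
  simp only [concatBlocks, itinerary]
  rw [firstBlock_iterate, Nat.div_add_mod']

theorem ae_tendsto_average_of_continuous {β : Type*} [Fintype β] [MeasurableSpace β]
    [MeasurableSingletonClass β] [TopologicalSpace β] [DiscreteTopology β] {k : ℕ} (hk : 0 < k)
    {ν : Measure (ℕ → β)} [IsProbabilityMeasure ν] (hT : MeasurePreserving (shiftMap^[k]) ν ν)
    (hν : IsBernoulliBlock k ν) {ψ : (ℕ → β) → ℝ} (hψ : Continuous ψ) (hψm : Measurable ψ) :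
    ∀ᵐ ω ∂ν, Tendsto (fun n : ℕ => (n : ℝ)⁻¹ *
      ∑ s ∈ Finset.range n, ψ ((shiftMap^[k])^[s] ω)) atTop (𝓝 (∫ ω, ψ ω ∂ν)) := by
  obtain ⟨ω₀⟩ : Nonempty (ℕ → β) := nonempty_of_isProbabilityMeasure ν
  refine ae_tendsto_average_of_approx hT (measurable_firstBlock k) (hν.iIndepFun hk) hψm
    fun ε hε => ?_
  obtain ⟨L, hL⟩ := exists_forall_abs_sub_le_of_continuous hψ hε
  obtain ⟨C, hC⟩ := (isCompact_range hψ.abs).bddAbove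
  refine ⟨fun x => ψ fun n => if n < L then concatBlocks hk x n else ω₀ n, L, C, ?_,
    fun x => hC ⟨_, rfl⟩, fun ω => hL _ _ fun i hi => ?_⟩
  · intro x y hxy
    refine congrArg ψ (funext fun n => ?_)
    split_ifs with hn
    · simp only [concatBlocks]
      rw [hxy (n / k) ((Nat.div_le_self n k).trans_lt hn)]
    · rfl
  · rw [if_pos hi]
    exact (congrFun (concatBlocks_itinerary hk id ω) i).symm

theorem entPart_map {X Y : Type*} [MeasurableSpace X] [MeasurableSpace Y] (μ : Measure X)
    {χ : X → Y} (hχ : Measurable χ) {ι : Type*} [Fintype ι] [MeasurableSpace ι]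
    [MeasurableSingletonClass ι] {U : Y → ι} (hU : Measurable U) :
    entPart (μ.map χ) U = entPart μ (U ∘ χ) := by
  refine Finset.sum_congr rfl fun i _ => ?_
  rw [Measure.map_apply hχ (hU (measurableSet_singleton i)), preimage_comp]

theorem entPart_comp_equiv {X : Type*} [MeasurableSpace X] (μ : Measure X) {ι κ : Type*}
    [Fintype ι] [Fintype κ] (e : ι ≃ κ) (U : X → ι) : entPart μ (e ∘ U) = entPart μ U := by
  unfold entPart
  rw [← e.sum_comp]
  refine Finset.sum_congr rfl fun i _ => ?_
  congr 3
  ext x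
  simp

section Factor
variable {β γ : Type*} [Fintype β] [MeasurableSpace β] [MeasurableSingletonClass β]
  [MeasurableSpace γ]

/-- The image under `f` of the initial word of length `k`, as a word over `range f`. -/
def factorBlock (f : β → γ) (k : ℕ) (ω : ℕ → β) : Fin k → range f :=
  fun i => rangeFactorization f (firstBlock k ω i)

theorem measurable_factorBlock (f : β → γ) (k : ℕ) : Measurable (factorBlock f k) :=
  measurable_pi_lambda _ fun i => (measurable_of_finite _).comp (measurable_pi_apply (i : ℕ))

theorem IsBernoulliBlock.iIndepFun_factorBlock {k : ℕ} (hk : 0 < k) {ν : Measure (ℕ → β)}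
    (hν : IsBernoulliBlock k ν) (f : β → γ) :
    ProbabilityTheory.iIndepFun (fun s ω => factorBlock f k ((shiftMap^[k])^[s] ω)) ν :=
  (hν.iIndepFun hk).comp (fun _ w i => rangeFactorization f (w i))
    fun _ => measurable_of_finite _

theorem ksEntropy_map_eq_entPart [Countable γ] [MeasurableSingletonClass γ] {k : ℕ} (hk : 0 < k) {ν : Measure (ℕ → β)}
    [IsProbabilityMeasure ν] (hT : MeasurePreserving (shiftMap^[k]) ν ν)
    (hν : IsBernoulliBlock k ν) (f : β → γ) [Fintype (range f)] :
    ksEntropy (shiftMap^[k]) (ν.map fun ω n => f (ω n)) = entPart ν (factorBlock f k) := by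
  classical
  obtain ⟨ω₀⟩ : Nonempty (ℕ → β) := nonempty_of_isProbabilityMeasure ν
  set χ : (ℕ → β) → ℕ → γ := fun ω n => f (ω n) with hχdef
  have hχ : Measurable χ :=
    measurable_pi_lambda _ fun n => (measurable_of_finite f).comp (measurable_pi_apply n)
  have hg := measurable_factorBlock f k
  have hind := hν.iIndepFun_factorBlock hk f
  have hcomm : ∀ (i : ℕ) (ω : ℕ → β), (shiftMap^[k])^[i] (χ ω) = χ ((shiftMap^[k])^[i] ω) := by
    intro i ω
    funext n
    simp only [hχdef, shiftMap_iterate_iterate_apply]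
  have hjoin : ∀ {m : ℕ} {p : (ℕ → γ) → Fin m}, Measurable p → ∀ n : ℕ,
      entPart (ν.map χ) (fun x (i : Fin (n + 1)) => p ((shiftMap^[k])^[(i : ℕ)] x)) =
        entPart ν (fun ω (i : Fin (n + 1)) => p (χ ((shiftMap^[k])^[(i : ℕ)] ω))) := by
    intro m p hp n
    refine (entPart_map ν hχ (U := fun x (i : Fin (n + 1)) => p ((shiftMap^[k])^[(i : ℕ)] x))
      (measurable_pi_lambda _ fun i : Fin (n + 1) =>
        hp.comp ((measurable_shiftMap.iterate k).iterate (i : ℕ)))).trans ?_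
    congr 1
    funext ω i
    simp only [Function.comp_apply, hcomm]
  have hle : ∀ (m : ℕ) (p : {p : (ℕ → γ) → Fin m // Measurable p}),
      ⨅ n : ℕ, ((n : ℝ) + 1)⁻¹ * entPart (ν.map χ)
        (fun x => fun i : Fin (n + 1) => p.1 ((shiftMap^[k])^[(i : ℕ)] x)) ≤
          entPart ν (factorBlock f k) := by
    rintro m ⟨p, hp⟩
    have hp' : Measurable fun y : ℕ → Fin k → range f =>
        p fun n => ((concatBlocks hk y n : range f) : γ) :=
      hp.comp (measurable_pi_lambda _ fun n => measurable_subtype_coe.comp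
        ((measurable_pi_apply _).comp (measurable_pi_apply _)))
    refine le_of_eq_of_le ?_ (iInf_entPart_le hT hg hind hp')
    refine iInf_congr fun n => ?_
    rw [hjoin hp n]
    congr 2
    funext ω i
    exact congrArg p (funext fun t => congrArg Subtype.val (congrFun
      (concatBlocks_itinerary hk (rangeFactorization f) ((shiftMap^[k])^[(i : ℕ)] ω)) t).symm)
  have h0 : 0 ≤ entPart ν (factorBlock f k) := entPart_nonneg _
  refine le_antisymm (Real.iSup_le (fun m => Real.iSup_le (hle m) h0) h0) ?_
  let e := Fintype.equivFin (Fin k → range f)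
  let r : γ → range f := fun c => if h : c ∈ range f then ⟨c, h⟩ else rangeFactorization f (ω₀ 0)
  let p : (ℕ → γ) → Fin (Fintype.card (Fin k → range f)) := fun x => e fun i => r (x i)
  have hp : Measurable p := (measurable_of_finite e).comp (measurable_pi_lambda _ fun i =>
    (measurable_of_countable r).comp (measurable_pi_apply (i : ℕ)))
  have hpχ : ∀ ω, p (χ ω) = e (factorBlock f k ω) := by
    intro ω
    refine congrArg e (funext fun i => ?_)
    exact dif_pos (mem_range_self _)
  have hpval : ⨅ n : ℕ, ((n : ℝ) + 1)⁻¹ * entPart (ν.map χ)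
      (fun x => fun i : Fin (n + 1) => p ((shiftMap^[k])^[(i : ℕ)] x)) =
        entPart ν (factorBlock f k) := by
    have hconst : ∀ n : ℕ, ((n : ℝ) + 1)⁻¹ * entPart (ν.map χ)
        (fun x => fun i : Fin (n + 1) => p ((shiftMap^[k])^[(i : ℕ)] x)) =
          entPart ν (factorBlock f k) := by
      intro n
      have hn : ((n : ℝ) + 1) ≠ 0 := by positivity
      rw [hjoin hp n, inv_mul_eq_iff_eq_mul₀ hn]
      have hw := entPart_word hT hg hind (n + 1)
      push_cast at hw
      rw [← hw, ← entPart_comp_equiv ν (Equiv.piCongrRight fun _ : Fin (n + 1) => e)]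
      congr 1
      funext ω i
      exact hpχ _
    simp only [hconst, ciInf_const]
  rw [← hpval]
  exact (le_ciSup (f := fun p : {p : (ℕ → γ) → Fin _ // Measurable p} =>
      ⨅ n : ℕ, ((n : ℝ) + 1)⁻¹ * entPart (ν.map χ)
        (fun x => fun i : Fin (n + 1) => p.1 ((shiftMap^[k])^[(i : ℕ)] x)))
      ⟨_, by rintro _ ⟨p, rfl⟩; exact hle _ p⟩ ⟨p, hp⟩).trans
    (le_ciSup (f := fun m : ℕ => ⨆ p : {p : (ℕ → γ) → Fin m // Measurable p},
      ⨅ n : ℕ, ((n : ℝ) + 1)⁻¹ * entPart (ν.map χ)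
        (fun x => fun i : Fin (n + 1) => p.1 ((shiftMap^[k])^[(i : ℕ)] x)))
      ⟨_, by rintro _ ⟨m, rfl⟩; exact Real.iSup_le (hle m) h0⟩ _)

end Factor

theorem exists_measurableSet_forall_abs_average_sub_lt {Ω ι : Type*} [MeasurableSpace Ω]
    [Fintype ι] {P : Measure Ω} [IsProbabilityMeasure P] {f : ℕ → ι → Ω → ℝ} {c : ι → ℝ}
    (hf : ∀ n i, Measurable (f n i))
    (hlim : ∀ i, ∀ᵐ ω ∂P, Tendsto (fun n => f n i ω) atTop (𝓝 (c i)))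
    {ε δ : ℝ} (hε : 0 < ε) (hδ : 0 < δ) :
    ∃ N : ℕ, ∃ S : Set Ω, MeasurableSet S ∧ ENNReal.ofReal (1 - δ) < P S ∧
      ∀ ω ∈ S, ∀ n, N ≤ n → ∀ i, |f n i ω - c i| < ε := by
  have hδ' : 0 < min (δ / 2) (1 / 2) := by positivity
  obtain ⟨t, ht, htP, hu⟩ := tendstoUniformlyOn_of_ae_tendsto' (μ := P)
    (f := fun n ω i => f n i ω) (g := fun _ => c)
    (fun n => (measurable_pi_lambda _ fun i => hf n i).stronglyMeasurable)
    stronglyMeasurable_const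
    (by filter_upwards [ae_all_iff.2 hlim] with ω hω using tendsto_pi_nhds.2 hω) hδ'
  obtain ⟨N, hN⟩ := eventually_atTop.1 (Metric.tendstoUniformlyOn_iff.1 hu ε hε)
  refine ⟨N, tᶜ, ht.compl, ?_, fun ω hω n hn i => ?_⟩
  · rw [prob_compl_eq_one_sub ht]
    refine lt_of_lt_of_le ?_ (tsub_le_tsub_left htP 1)
    rw [← ENNReal.ofReal_one, ← ENNReal.ofReal_sub _ hδ'.le]
    have h1 := min_le_left (δ / 2) (1 / 2)
    have h2 := min_le_right (δ / 2) (1 / 2)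
    exact (ENNReal.ofReal_lt_ofReal_iff (by linarith)).2 (by linarith)
  · have := (dist_pi_lt_iff hε).1 (hN n hn ω hω) i
    rwa [dist_comm, Real.dist_eq] at this

theorem average_birkAvg {β : Type*} (k n : ℕ) (φ : (ℕ → β) → ℝ) (ω : ℕ → β) :
    (n : ℝ)⁻¹ * ∑ s ∈ Finset.range n, birkAvg k φ ((shiftMap^[k])^[s] ω) =
      ((n * k : ℝ))⁻¹ * ∑ r ∈ Finset.range (n * k), φ (shiftMap^[r] ω) := by
  simp only [birkAvg]
  rw [sum_range_mul_eq, ← Finset.mul_sum, mul_inv, mul_assoc]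
  congr 2
  refine Finset.sum_congr rfl fun s _ => Finset.sum_congr rfl fun c _ => ?_
  rw [← Function.iterate_mul, ← Function.iterate_add_apply, mul_comm k, add_comm c]

section Factor
variable {β γ : Type*} [Fintype β] [MeasurableSpace β] [MeasurableSingletonClass β]
  [MeasurableSpace γ] [MeasurableSingletonClass γ]

theorem map_cylinderSet_eq_prod {k : ℕ} (hk : 0 < k) {ν : Measure (ℕ → β)}
    [IsProbabilityMeasure ν] (hT : MeasurePreserving (shiftMap^[k]) ν ν)
    (hν : IsBernoulliBlock k ν) (f : β → γ) (n : ℕ) (ω : ℕ → β) :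
    ((ν.map fun ω n => f (ω n)) (cylinderSet (n * k) fun i => f (ω i))).toReal =
      ∏ s ∈ Finset.range n,
        ν.real (factorBlock f k ⁻¹' {factorBlock f k ((shiftMap^[k])^[s] ω)}) := by
  classical
  have hχ : Measurable fun (ω : ℕ → β) n => f (ω n) :=
    measurable_pi_lambda _ fun n => (measurable_of_finite f).comp (measurable_pi_apply n)
  have hcyl : MeasurableSet (cylinderSet (n * k) fun i => f (ω i)) := by
    simp only [cylinderSet, ofPred_forall]
    exact MeasurableSet.iInter fun i => measurable_pi_apply (i : ℕ) (measurableSet_singleton _)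
  have : Finite (range f) := Set.finite_range f
  rw [Measure.map_apply hχ hcyl, Finset.prod_range, ← measureReal_word_eq_prod hT
    (measurable_factorBlock f k) (hν.iIndepFun_factorBlock hk f) n
    fun s => factorBlock f k ((shiftMap^[k])^[(s : ℕ)] ω)]
  change ν.real _ = _
  congr 1
  ext ω'
  have hiff : ∀ s : ℕ, factorBlock f k ((shiftMap^[k])^[s] ω') =
      factorBlock f k ((shiftMap^[k])^[s] ω) ↔
        ∀ i : Fin k, f (ω' (s * k + i)) = f (ω (s * k + i)) := by
    intro s
    simp only [funext_iff, factorBlock, firstBlock_iterate, Subtype.ext_iff,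
      rangeFactorization_coe]
  simp only [mem_preimage, cylinderSet, mem_ofPred_eq, hiff]
  constructor
  · exact fun h s i => h (blockIdx s i)
  · intro h i
    have := h ⟨i / k, Nat.div_lt_of_lt_mul (i.2.trans_eq (mul_comm _ _))⟩
      ⟨i % k, Nat.mod_lt _ hk⟩
    simpa only [Nat.div_add_mod'] using this

theorem integral_log_factorBlock {k : ℕ} {ν : Measure (ℕ → β)} [IsProbabilityMeasure ν]
    (f : β → γ) [Fintype (range f)] :
    ∫ ω, Real.log (ν.real (factorBlock f k ⁻¹' {factorBlock f k ω})) ∂ν =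
      -entPart ν (factorBlock f k) := by
  classical
  have hg := measurable_factorBlock f k
  have := Measure.isProbabilityMeasure_map (μ := ν) hg.aemeasurable
  rw [← integral_map (φ := factorBlock f k)
      (f := fun x => Real.log (ν.real (factorBlock f k ⁻¹' {x}))) hg.aemeasurable
      (measurable_of_finite _).aestronglyMeasurable, integral_fintype (.of_finite), entPart,
    ← Finset.sum_neg_distrib]
  refine Finset.sum_congr rfl fun x _ => ?_
  rw [map_measureReal_apply hg (measurableSet_singleton x), Real.negMulLog, smul_eq_mul,
    neg_mul, neg_neg]
  rfl

theorem exists_good_set_of_factor [Countable γ] [TopologicalSpace β] [DiscreteTopology β]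
    {m k : ℕ} (hk : 0 < k) (ν : Measure (ℕ → β)) [IsProbabilityMeasure ν]
    (hT : MeasurePreserving (shiftMap^[k]) ν ν) (hν : IsBernoulliBlock k ν)
    (hνpos : ∀ w : Fin k → β, 0 < ν (cylinderSet k w))
    (φ : Fin m → (ℕ → β) → ℝ) (hφ : ∀ l, Continuous (φ l)) (f : β → γ)
    {ε δ : ℝ} (hε : 0 < ε) (hδ : 0 < δ) :
    ∃ N : ℕ, ∃ S : Set (ℕ → β), MeasurableSet S ∧ ENNReal.ofReal (1 - δ) < ν S ∧
      ∀ ω ∈ S, ∀ n : ℕ, N ≤ n → ∀ l : Fin m,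
        (|((n * k : ℝ))⁻¹ * (∑ r ∈ Finset.range (n * k), φ l (shiftMap^[r] ω)) -
            (∫ ω', birkAvg k (φ l) ω' ∂ν)| < ε) ∧
        (|((n * k : ℝ))⁻¹ * Real.log (((ν.map fun ω n => f (ω n))
              (cylinderSet (n * k) fun i : Fin (n * k) => f (ω i))).toReal) +
            (k : ℝ)⁻¹ * ksEntropy (shiftMap^[k]) (ν.map fun ω n => f (ω n))| < ε) ∧
        (∀ v : β, ∃ r < N, ω r = v) := by
  classical
  have hfin : Finite (range f) := Set.finite_range f
  let _ : Fintype (range f) := Fintype.ofFinite _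
  let _ : TopologicalSpace (range f) := ⊥
  have : DiscreteTopology (range f) := ⟨rfl⟩
  have : BorelSpace β := inferInstance
  let q : (ℕ → β) → ℝ := fun ω => ν.real (factorBlock f k ⁻¹' {factorBlock f k ω})
  have hq : ∀ ω, 0 < q ω := by
    intro ω
    refine ENNReal.toReal_pos (ne_of_gt ?_) (measure_ne_top _ _)
    refine (hνpos (firstBlock k ω)).trans_le (measure_mono fun ω' h => ?_)
    exact funext fun i => congrArg (rangeFactorization f) (h i)
  have hv : ∀ v : β, 0 < ν.real {ω | ω 0 = v} := by
    intro v
    refine ENNReal.toReal_pos (ne_of_gt ?_) (measure_ne_top _ _)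
    exact (hνpos fun _ => v).trans_le (measure_mono fun ω' h => h ⟨0, hk⟩)
  let ψ : Fin m ⊕ Option β → (ℕ → β) → ℝ := Sum.elim (fun l => birkAvg k (φ l))
    fun o => o.elim (fun ω => (k : ℝ)⁻¹ * Real.log (q ω))
      fun v ω => if ω 0 = v then ε / ν.real {ω | ω 0 = v} else 0
  have hψ : ∀ i, Continuous (ψ i) := by
    rintro (l | _ | v)
    · exact continuous_const.mul (continuous_finsetSum _ fun i _ =>
        (hφ l).comp (continuous_shiftMap.iterate i))
    · have hg : Continuous (factorBlock f k) :=
        continuous_pi fun i => continuous_of_discreteTopology.comp (continuous_apply (i : ℕ))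
      exact (continuous_of_discreteTopology (f := fun x : Fin k → range f =>
        (k : ℝ)⁻¹ * Real.log (ν.real (factorBlock f k ⁻¹' {x})))).comp hg
    · exact (continuous_of_discreteTopology (f := fun b : β =>
        if b = v then ε / ν.real {ω | ω 0 = v} else 0)).comp (continuous_apply 0)
  have hψm : ∀ i, Measurable (ψ i) := fun i => (hψ i).measurable
  obtain ⟨N, S, hS, hSν, h⟩ := exists_measurableSet_forall_abs_average_sub_lt (P := ν)
    (f := fun n i ω => (n : ℝ)⁻¹ * ∑ s ∈ Finset.range n, ψ i ((shiftMap^[k])^[s] ω))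
    (c := fun i => ∫ ω, ψ i ω ∂ν)
    (fun n i => (Finset.measurable_fun_sum _ fun s _ =>
      (hψm i).comp ((measurable_shiftMap.iterate k).iterate s)).const_mul _)
    (fun i => ae_tendsto_average_of_continuous hk hT hν (hψ i) (hψm i)) hε hδ
  refine ⟨(N + 1) * k, S, hS, hSν, fun ω hω n hn l => ⟨?_, ?_, fun v => ?_⟩⟩
  all_goals have hNn : N ≤ n := by nlinarith
  · rw [← average_birkAvg]
    exact h ω hω n hNn (Sum.inl l)
  · have := h ω hω n hNn (Sum.inr none)
    simp only [ψ, Sum.elim_inr, Option.elim_none, integral_const_mul, q] at this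
    rw [integral_log_factorBlock] at this
    rw [ksEntropy_map_eq_entPart hk hT hν f, map_cylinderSet_eq_prod hk hT hν f,
      Real.log_prod fun s _ => (hq _).ne', mul_inv, mul_assoc, Finset.mul_sum]
    rwa [mul_neg, sub_neg_eq_add] at this
  · have := h ω hω (N + 1) N.le_succ (Sum.inr (some v))
    simp only [ψ, Sum.elim_inr, Option.elim_some] at this
    have hint : ∫ ω : ℕ → β, (if ω 0 = v then ε / ν.real {ω | ω 0 = v} else 0) ∂ν = ε := by
      have hm : MeasurableSet {ω : ℕ → β | ω 0 = v} :=
        (measurableSet_singleton v).preimage (measurable_pi_apply (X := fun _ : ℕ => β) 0)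
      have := integral_indicator_const (μ := ν) (ε / ν.real {ω : ℕ → β | ω 0 = v}) hm
      rw [smul_eq_mul, mul_div_cancel₀ _ (hv v).ne'] at this
      exact this
    rw [hint] at this
    by_contra! hne
    rw [Finset.sum_eq_zero, mul_zero, zero_sub, abs_neg, abs_of_pos hε] at this
    · exact this.false
    · intro s hs
      refine if_neg ?_
      rw [shiftMap_iterate_iterate_apply]
      exact hne _ (Nat.mul_lt_mul_of_pos_right (Finset.mem_range.1 hs) hk)

end Factor

/-- **Lemma (uniform Birkhoff/Shannon–McMillan–Breiman estimates on a large set).** -/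
theorem exists_good_set_of_bernoulli_block
    {d m : ℕ} (a : Fin (d + 1) → ℕ) (ha : StrictAnti a) (ha2 : ∀ q, 2 ≤ a q)
    (D : Finset (Fin (d + 1) → ℕ)) (hD : ∀ v ∈ D, ∀ q, v q < a q) (hDne : D.Nonempty)
    (k : ℕ) (hk : 0 < k) (ν : Measure (SymbSpace D)) (hνp : IsProbabilityMeasure ν)
    (hνinv : ν.map (shiftMap^[k]) = ν) (hνb : IsBernoulliBlock k ν)
    (hνpos : ∀ w : Fin k → {v // v ∈ D}, 0 < ν (cylinderSet k w))
    (φs : Fin m → SymbSpace D → ℝ) (hφs : ∀ l, Continuous (φs l))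
    (j : Fin (d + 1)) (ε δ : ℝ) (hε : 0 < ε) (hδ : 0 < δ) :
    ∃ N : ℕ, ∃ S : Set (SymbSpace D), MeasurableSet S ∧ ENNReal.ofReal (1 - δ) < ν S ∧
      ∀ ω ∈ S, ∀ n : ℕ, N ≤ n → ∀ l : Fin m,
        (|((n * k : ℝ))⁻¹ * (∑ r ∈ Finset.range (n * k), φs l (shiftMap^[r] ω)) -
            (∫ ω', birkAvg k (φs l) ω' ∂ν)| < ε) ∧
        (|((n * k : ℝ))⁻¹ *
            Real.log (((ν.map (chi D j))
              (cylinderSet (n * k) (fun i : Fin (n * k) => ηmap j (ω i.1).1))).toReal) +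
            (k : ℝ)⁻¹ * ksEntropy (shiftMap^[k]) (ν.map (chi D j))| < ε) ∧
        (∀ v : {v // v ∈ D}, ∃ r < N, ω r = v) := by
  have : Finite (TruncIdx d j) := inferInstanceAs (Finite {q : Fin (d + 1) // _})
  exact exists_good_set_of_factor hk ν ⟨measurable_shiftMap.iterate k, hνinv⟩ hνb hνpos φs hφs
    (fun v : {v // v ∈ D} => ηmap j v.1) hε hδ

end
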